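/- Fix V > 0 and a Bond number B > 0, set κ := √B, Υ(κ) := I₁(κ)L₀(κ) − I₀(κ)L₁(κ), d₀ := [3πΥ(κ) + 2B·I₀(κ) − 6√B·I₁(κ)]/(3B·I₂(κ)), λ*₀ := (18V/π)·[6d₀ − 3 + 18(1−d₀)πΥ(κ)/(B·I₀(κ)) + 3·₂F₃(1,2;3/2,5/2,3;B/4) − 9π²L₀(κ)Υ(κ)/(B^{3/2}·I₀(κ))]^{−1}, and define h₀*(r) := (λ*₀/3)[3d₀r/2 − r²] + λ*₀(1−d₀)·I₁(κr)/(κ·I₀(κ)) + (λ*₀π/(2B))·[L₁(κr) − L₀(κ)·I₁(κr)/I₀(κ)] for r ∈ [0,1]. Then: h₀*(0) = 0, h₀*(1) = 0, h₀*(r) ≥ 0 for all r ∈ [0,1], ∫_0^1 h₀*(r)·r dr = V/(2π) (so h₀* ∈ M_V), and the function −h₀* is not convex on [0,1]. -/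

import Mathlib

/-- Modified Bessel function of the first kind of (natural) order `n`,
`I_n(x) = sum_k (x/2)^(2k+n) / (k! * Gamma (k+n+1))`. -/
noncomputable def besselI (n : ℕ) (x : ℝ) : ℝ :=
  ∑' k : ℕ, (x / 2) ^ (2 * k + n) / ((k.factorial : ℝ) * Real.Gamma (k + n + 1))

/-- Modified Struve function of the first kind of (natural) order `n`,
`L_n(x) = sum_k (x/2)^(2k+n+1) / (Gamma (k+3/2) * Gamma (k+n+3/2))`. -/
noncomputable def struveL (n : ℕ) (x : ℝ) : ℝ :=
  ∑' k : ℕ, (x / 2) ^ (2 * k + n + 1) /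
    (Real.Gamma (k + 3 / 2) * Real.Gamma (k + n + 3 / 2))

/-- Rising factorial (Pochhammer symbol) `(a)_k`. -/
noncomputable def risingFactorial (a : ℝ) (k : ℕ) : ℝ :=
  ∏ i ∈ Finset.range k, (a + i)

/-- The generalized hypergeometric function `2F3(1, 2; 3/2, 5/2, 3; z)`. -/
noncomputable def hyp2F3 (z : ℝ) : ℝ :=
  ∑' k : ℕ, risingFactorial 1 k * risingFactorial 2 k /
    (risingFactorial (3 / 2) k * risingFactorial (5 / 2) k * risingFactorial 3 k) *
    z ^ k / (k.factorial : ℝ)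

section HalfPowerSeries

variable {a : ℕ → ℝ} {C : ℝ}

lemma summable_half_pow (ha : ∀ k, |a k| ≤ C / (k.factorial : ℝ)) (n : ℕ) (x : ℝ) :
    Summable fun k : ℕ => a k * (x / 2) ^ (2 * k + n) := by
  refine Summable.of_norm_bounded (g := fun k : ℕ =>
    (C * |x / 2| ^ n) * (((x / 2) ^ 2) ^ k / (k.factorial : ℝ)))
    ((Real.summable_pow_div_factorial _).mul_left _) fun k => ?_
  rw [Real.norm_eq_abs, abs_mul, abs_pow, pow_add, pow_mul, sq_abs]
  calc |a k| * (((x / 2) ^ 2) ^ k * |x / 2| ^ n)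
      ≤ C / (k.factorial : ℝ) * (((x / 2) ^ 2) ^ k * |x / 2| ^ n) := by
        gcongr
        exact ha k
    _ = _ := by ring

lemma add_half_le_mul_three_pow (n k : ℕ) : (k : ℝ) + (n + 1) / 2 ≤ (n + 1) * 3 ^ k := by
  have h := one_add_mul_le_pow (show (-2 : ℝ) ≤ 2 by norm_num) k
  norm_num at h
  have hn : (0 : ℝ) ≤ n := Nat.cast_nonneg n
  have hk : (0 : ℝ) ≤ k := Nat.cast_nonneg k
  nlinarith [mul_le_mul_of_nonneg_left h (show (0 : ℝ) ≤ n + 1 by positivity), mul_nonneg hk hn]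

lemma hasDerivAt_tsum_half_pow (ha : ∀ k, |a k| ≤ C / (k.factorial : ℝ)) (n : ℕ) (x : ℝ) :
    HasDerivAt (fun y : ℝ => ∑' k : ℕ, a k * (y / 2) ^ (2 * k + n + 1))
      (∑' k : ℕ, a k * ((k : ℝ) + (n + 1) / 2) * (x / 2) ^ (2 * k + n)) x := by
  have hC : 0 ≤ C := by simpa using (abs_nonneg _).trans (ha 0)
  set R : ℝ := |x / 2| + 1
  have hsum : Summable fun k : ℕ =>
      (C * ((n : ℝ) + 1) * R ^ n) * ((3 * R ^ 2) ^ k / (k.factorial : ℝ)) :=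
    (Real.summable_pow_div_factorial _).mul_left _
  have hx : x ∈ Metric.ball (0 : ℝ) (2 * R) := by
    rw [mem_ball_zero_iff, Real.norm_eq_abs]
    have : |x / 2| = |x| / 2 := by rw [abs_div, abs_two]
    simp only [R, this]
    linarith
  have hsum' : Summable fun k : ℕ => a k * (x / 2) ^ (2 * k + n + 1) :=
    summable_half_pow ha (n + 1) x
  refine hasDerivAt_tsum_of_isPreconnected (𝕜 := ℝ) (F := ℝ)
    (g := fun k y => a k * (y / 2) ^ (2 * k + n + 1))
    (g' := fun k y => a k * ((k : ℝ) + (n + 1) / 2) * (y / 2) ^ (2 * k + n)) hsum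
    Metric.isOpen_ball (convex_ball (0 : ℝ) (2 * R)).isPreconnected (fun k y _ => ?_)
    (fun k y hy => ?_) hx hsum' hx
  · have h := (((hasDerivAt_id' y).div_const 2).fun_pow (2 * k + n + 1)).const_mul (a k)
    refine h.congr_deriv ?_
    simp only [Nat.add_sub_cancel]
    push_cast
    ring
  · have hy' : |y / 2| ≤ R := by
      rw [mem_ball_zero_iff, Real.norm_eq_abs] at hy
      rw [abs_div, abs_two]
      linarith
    rw [Real.norm_eq_abs, abs_mul, abs_mul, abs_pow,
      abs_of_nonneg (show (0 : ℝ) ≤ k + (n + 1) / 2 by positivity)]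
    calc |a k| * ((k : ℝ) + (n + 1) / 2) * |y / 2| ^ (2 * k + n)
        ≤ C / (k.factorial : ℝ) * ((n + 1) * 3 ^ k) * R ^ (2 * k + n) := by
          gcongr
          · exact ha k
          · exact add_half_le_mul_three_pow n k
      _ = _ := by rw [mul_pow, pow_add, pow_mul]; ring

end HalfPowerSeries

section BesselStruve

lemma besselI_eq (n : ℕ) (x : ℝ) : besselI n x =
    ∑' k : ℕ, ((k.factorial : ℝ) * ((k + n).factorial : ℝ))⁻¹ * (x / 2) ^ (2 * k + n) := by
  refine tsum_congr fun k => ?_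
  rw [← Nat.cast_add, Real.Gamma_nat_eq_factorial]
  ring

lemma struveL_eq (n : ℕ) (x : ℝ) : struveL n x =
    ∑' k : ℕ, (Real.Gamma (k + 3 / 2) * Real.Gamma (k + n + 3 / 2))⁻¹ *
      (x / 2) ^ (2 * k + n + 1) :=
  tsum_congr fun k => by ring

lemma abs_besselI_coeff_le (n k : ℕ) :
    |((k.factorial : ℝ) * ((k + n).factorial : ℝ))⁻¹| ≤ 1 / (k.factorial : ℝ) := by
  have h1 : (1 : ℝ) ≤ ((k + n).factorial : ℝ) := by exact_mod_cast Nat.factorial_pos _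
  have h2 : (0 : ℝ) < (k.factorial : ℝ) := by positivity
  rw [abs_of_pos (by positivity), ← one_div]
  gcongr
  nlinarith

lemma Gamma_add_three_halves_pos (k : ℕ) : 0 < Real.Gamma (k + 3 / 2) :=
  Real.Gamma_pos_of_pos (by positivity)

lemma Gamma_succ_add_three_halves (k : ℕ) :
    Real.Gamma ((k + 1 : ℕ) + 3 / 2) = ((k : ℝ) + 3 / 2) * Real.Gamma (k + 3 / 2) := by
  rw [← Real.Gamma_add_one (by positivity)]
  congr 1
  push_cast
  ring

lemma Gamma_three_halves : Real.Gamma (3 / 2) = √Real.pi / 2 := by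
  rw [show (3 / 2 : ℝ) = 1 / 2 + 1 by norm_num, Real.Gamma_add_one (by norm_num),
    Real.Gamma_one_half_eq]
  ring

lemma factorial_le_two_mul_Gamma (k : ℕ) :
    (k.factorial : ℝ) ≤ 2 * Real.Gamma (k + 3 / 2) := by
  induction k with
  | zero =>
    have : 1 ≤ √Real.pi := Real.one_le_sqrt.2 (by linarith [Real.pi_gt_three])
    simp only [Nat.factorial_zero, Nat.cast_one, Nat.cast_zero, zero_add, Gamma_three_halves]
    linarith
  | succ k ih =>
    rw [Gamma_succ_add_three_halves, Nat.factorial_succ]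
    push_cast
    nlinarith [Gamma_add_three_halves_pos k, (Nat.cast_nonneg k : (0 : ℝ) ≤ k)]

lemma abs_struveL_coeff_le (n k : ℕ) :
    |(Real.Gamma (k + 3 / 2) * Real.Gamma (k + n + 3 / 2))⁻¹| ≤ 4 / (k.factorial : ℝ) := by
  have h1 := factorial_le_two_mul_Gamma k
  have h2 := factorial_le_two_mul_Gamma (k + n)
  have h3 : (1 : ℝ) ≤ ((k + n).factorial : ℝ) := by exact_mod_cast Nat.factorial_pos _
  have h4 := Gamma_add_three_halves_pos k
  have h5 := Gamma_add_three_halves_pos (k + n)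
  push_cast at h2 h5
  have h6 : (0 : ℝ) < (k.factorial : ℝ) := by positivity
  rw [abs_of_pos (by positivity), ← one_div, div_le_div_iff₀ (by positivity) h6]
  nlinarith

lemma hasDerivAt_besselI_zero (x : ℝ) : HasDerivAt (besselI 0) (besselI 1 x) x := by
  have hb : ∀ k : ℕ, |(((k + 1).factorial : ℝ) * ((k + 1).factorial : ℝ))⁻¹|
      ≤ 1 / (k.factorial : ℝ) := fun k => by
    refine (abs_besselI_coeff_le 0 (k + 1)).trans ?_
    gcongr
    omega
  have h := (hasDerivAt_tsum_half_pow hb 1 x).const_add 1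
  refine (h.congr_deriv ?_).congr_of_eventuallyEq (.of_forall fun y => ?_)
  rotate_left
  · rw [besselI_eq, (summable_half_pow (abs_besselI_coeff_le 0) 0 y).tsum_eq_zero_add]
    simp [mul_add, add_assoc]
  · symm
    rw [besselI_eq]
    refine tsum_congr fun k => ?_
    rw [Nat.factorial_succ]
    push_cast
    field_simp
    ring

lemma differentiable_besselI_one : Differentiable ℝ (besselI 1) := fun x =>
  (hasDerivAt_tsum_half_pow (abs_besselI_coeff_le 1) 0 x).congr_of_eventuallyEq
    (.of_forall fun y => besselI_eq 1 y) |>.differentiableAt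

lemma hasDerivAt_mul_besselI_one (x : ℝ) :
    HasDerivAt (fun y => y * besselI 1 y) (x * besselI 0 x) x := by
  have h := (hasDerivAt_tsum_half_pow (abs_besselI_coeff_le 1) 1 x).const_mul 2
  refine (h.congr_deriv ?_).congr_of_eventuallyEq (.of_forall fun y => ?_)
  rotate_left
  · beta_reduce
    rw [besselI_eq, ← tsum_mul_left, ← tsum_mul_left]
    exact tsum_congr fun k => by ring
  · symm
    rw [besselI_eq, ← tsum_mul_left, ← tsum_mul_left]
    refine tsum_congr fun k => ?_
    simp only [Nat.factorial_succ, add_zero]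
    push_cast
    field_simp
    ring

lemma hasDerivAt_struveL_zero (x : ℝ) :
    HasDerivAt (struveL 0) (2 / Real.pi + struveL 1 x) x := by
  have h := hasDerivAt_tsum_half_pow (abs_struveL_coeff_le 0) 0 x
  refine (h.congr_deriv ?_).congr_of_eventuallyEq (.of_forall fun y => ?_)
  rotate_left
  · exact struveL_eq 0 y
  · have key : ∀ k : ℕ, (Real.Gamma ((k + 1 : ℕ) + 3 / 2) *
        Real.Gamma ((k + 1 : ℕ) + (0 : ℕ) + 3 / 2))⁻¹ * (((k + 1 : ℕ) : ℝ) + ((0 : ℕ) + 1) / 2) *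
        (x / 2) ^ (2 * (k + 1) + 0) = (Real.Gamma (k + 3 / 2) *
        Real.Gamma (k + (1 : ℕ) + 3 / 2))⁻¹ * (x / 2) ^ (2 * k + 1 + 1) := fun k => by
      have h1 := Gamma_succ_add_three_halves k
      have h2 := Gamma_add_three_halves_pos k
      push_cast at h1 ⊢
      simp only [add_zero, h1]
      field_simp
      ring
    rw [tsum_eq_zero_add' (by
        simp only [key]
        exact summable_half_pow (abs_struveL_coeff_le 1) 2 x), struveL_eq]
    simp only [key]
    congr 1
    simp only [Nat.cast_zero, zero_add, add_zero, mul_zero, pow_zero, Gamma_three_halves]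
    field_simp
    rw [Real.sq_sqrt Real.pi_pos.le]

lemma differentiable_struveL_one : Differentiable ℝ (struveL 1) := fun x =>
  (hasDerivAt_tsum_half_pow (abs_struveL_coeff_le 1) 1 x).congr_of_eventuallyEq
    (.of_forall fun y => struveL_eq 1 y) |>.differentiableAt

lemma hasDerivAt_mul_struveL_one (x : ℝ) :
    HasDerivAt (fun y => y * struveL 1 y) (x * struveL 0 x) x := by
  have h := (hasDerivAt_tsum_half_pow (abs_struveL_coeff_le 1) 2 x).const_mul 2
  refine (h.congr_deriv ?_).congr_of_eventuallyEq (.of_forall fun y => ?_)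
  rotate_left
  · beta_reduce
    rw [struveL_eq, ← tsum_mul_left, ← tsum_mul_left]
    exact tsum_congr fun k => by ring
  · symm
    rw [struveL_eq, ← tsum_mul_left, ← tsum_mul_left]
    refine tsum_congr fun k => ?_
    have h1 := Gamma_succ_add_three_halves k
    have h2 := Gamma_add_three_halves_pos k
    push_cast at h1 ⊢
    simp only [add_zero, h1]
    field_simp
    ring

lemma besselI_pos (n : ℕ) {x : ℝ} (hx : 0 < x) : 0 < besselI n x := by
  rw [besselI_eq]
  exact (summable_half_pow (abs_besselI_coeff_le n) n x).tsum_pos (fun k => by positivity) 0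
    (by positivity)

lemma mul_besselI_two (x : ℝ) : x * besselI 2 x = x * besselI 0 x - 2 * besselI 1 x := by
  have s0 := summable_half_pow (abs_besselI_coeff_le 0) 0 x
  have s1 := summable_half_pow (abs_besselI_coeff_le 1) 1 x
  have s2 := summable_half_pow (abs_besselI_coeff_le 2) 2 x
  simp only [besselI_eq]
  rw [← tsum_mul_left, ← tsum_mul_left, ← tsum_mul_left,
    ← (s0.mul_left x).tsum_sub (s1.mul_left 2),
    ((s0.mul_left x).sub (s1.mul_left 2)).tsum_eq_zero_add]
  have : x * (((0 : ℕ).factorial : ℝ) * ((0 + 0 : ℕ).factorial : ℝ))⁻¹ * (x / 2) ^ (2 * 0 + 0)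
      - 2 * ((((0 : ℕ).factorial : ℝ) * ((0 + 1 : ℕ).factorial : ℝ))⁻¹ *
        (x / 2) ^ (2 * 0 + 1)) = 0 := by
    simp
    ring
  rw [mul_assoc] at this
  rw [this, zero_add]
  refine tsum_congr fun k => ?_
  simp only [Nat.factorial_succ, add_zero, show k + 2 = k + 1 + 1 from rfl]
  push_cast
  field_simp
  ring

end BesselStruve

section SingularODE

open Filter Topology

lemma eventually_lt_of_second_deriv_pos {f q : ℝ → ℝ} {x c : ℝ}
    (hf : ∀ᶠ y in 𝓝 x, HasDerivAt f (q y) y)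
    (hx : q x = 0) (hq : HasDerivAt q c x) (hc : 0 < c) : ∀ᶠ y in 𝓝[≠] x, f x < f y := by
  have hg : ∀ᶠ y in 𝓝 x, HasDerivAt (fun z => f z - c / 4 * (z - x) ^ 2)
      (q y - c / 2 * (y - x)) y := hf.mono fun y hy => by
    refine (hy.sub ((((hasDerivAt_id y).sub_const x).pow 2).const_mul (c / 4))).congr_deriv ?_
    simp only [id]
    ring
  have hd : deriv (fun z => f z - c / 4 * (z - x) ^ 2) =ᶠ[𝓝 x] fun y => q y - c / 2 * (y - x) :=
    hg.mono fun y hy => hy.deriv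
  have hdd : deriv (deriv fun z => f z - c / 4 * (z - x) ^ 2) x = c / 2 := by
    rw [hd.deriv_eq]
    refine ((hq.sub (((hasDerivAt_id x).sub_const x).const_mul (c / 2))).congr_deriv ?_).deriv
    ring
  have hmin := isLocalMin_of_deriv_deriv_pos (f := fun z => f z - c / 4 * (z - x) ^ 2)
    (by rw [hdd]; positivity) (by rw [hd.self_of_nhds]; simp [hx])
    hg.self_of_nhds.continuousAt
  filter_upwards [hmin.filter_mono nhdsWithin_le_nhds, self_mem_nhdsWithin] with y hy hne
  have : 0 < (y - x) ^ 2 := by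
    have := sub_ne_zero.2 hne
    positivity
  simp only [sub_self] at hy
  nlinarith

/-- A solution `g` of the Bessel-type system `(r g)' = r p`, `p' = B (g + s)` with
`s = r ^ 2 / 3 - d r / 2` is nonnegative on `[0, 1]` if `g` vanishes at both ends and `p 1 = 0`. -/
lemma nonneg_of_bessel_system {B d : ℝ} (hB : 0 < B) {g p : ℝ → ℝ} (hgc : Continuous g)
    (hg : ∀ r, 0 < r → HasDerivAt g (p r - g r / r) r)
    (hp : ∀ r, HasDerivAt p (B * (g r + r ^ 2 / 3 - d * r / 2)) r)
    (g0 : g 0 = 0) (g1 : g 1 = 0) (p1 : p 1 = 0) : ∀ r ∈ Set.Icc (0 : ℝ) 1, 0 ≤ g r := by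
  have hgpos : ∀ r, 0 < r → ∀ᶠ y in 𝓝 r, HasDerivAt g (p y - g y / y) y := fun r hr =>
    (lt_mem_nhds hr).mono fun y hy => hg y hy
  have hq : ∀ r, 0 < r → p r - g r / r = 0 → HasDerivAt (fun y => p y - g y / y)
      (B * (g r + r ^ 2 / 3 - d * r / 2) + g r / r ^ 2) r := fun r hr h => by
    refine ((hp r).sub ((hg r hr).div (hasDerivAt_id r) hr.ne')).congr_deriv ?_
    rw [h]
    simp only [id]
    ring
  by_contra! hcon
  obtain ⟨r₀, hr₀, hneg⟩ := hcon
  obtain ⟨m, hm, hmin⟩ := isCompact_Icc.exists_isMinOn ⟨r₀, hr₀⟩ hgc.continuousOn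
  have gm : g m < 0 := lt_of_le_of_lt (hmin hr₀) hneg
  have hm0 : 0 < m := lt_of_le_of_ne hm.1 (by rintro rfl; linarith)
  have hm1 : m < 1 := lt_of_le_of_ne hm.2 (by rintro rfl; linarith)
  have hs : 3 * d / 2 < m := by
    have hqm : p m - g m / m = 0 :=
      (hmin.isLocalMin (Icc_mem_nhds hm0 hm1)).hasDerivAt_eq_zero (hg m hm0)
    by_contra! hle
    have hc : B * (g m + m ^ 2 / 3 - d * m / 2) + g m / m ^ 2 < 0 := by
      have : g m / m ^ 2 < 0 := div_neg_of_neg_of_pos gm (by positivity)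
      nlinarith [mul_nonneg hm0.le (sub_nonneg.2 hle)]
    have hlt := eventually_lt_of_second_deriv_pos (f := fun y => -g y)
      (q := fun y => -(p y - g y / y)) ((hgpos m hm0).mono fun y hy => hy.neg)
      (by simp [hqm]) (hq m hm0 hqm).neg (neg_pos.2 hc)
    obtain ⟨y, hy, hy'⟩ := (hlt.and (mem_nhdsWithin_of_mem_nhds (Icc_mem_nhds hm0 hm1))).exists
    have : g m ≤ g y := hmin hy'
    linarith
  obtain ⟨M, hM, hmax⟩ := isCompact_Icc.exists_isMaxOn (Set.nonempty_Icc.2 hm1.le)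
    hgc.continuousOn
  have gM : 0 ≤ g M := g1 ▸ hmax (Set.right_mem_Icc.2 hm1.le)
  have hmM : m < M := lt_of_le_of_ne hM.1 (by rintro rfl; linarith)
  have hM0 : 0 < M := hm0.trans hmM
  have hqM : p M - g M / M = 0 := by
    rcases hM.2.lt_or_eq with hM1 | rfl
    · exact (hmax.isLocalMax (Icc_mem_nhds hmM hM1)).hasDerivAt_eq_zero (hg M hM0)
    · simp [p1, g1]
  have hc : 0 < B * (g M + M ^ 2 / 3 - d * M / 2) + g M / M ^ 2 := by
    have h1 : 0 ≤ g M / M ^ 2 := by positivity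
    have h2 : 0 < M * (M / 3 - d / 2) := mul_pos hM0 (by linarith)
    have h3 : 0 < B * (g M + M ^ 2 / 3 - d * M / 2) := mul_pos hB (by linarith)
    linarith
  have hlt := eventually_lt_of_second_deriv_pos (hgpos M hM0) hqM (hq M hM0 hqM) hc
  have hlt' : ∀ᶠ y in 𝓝[<] M, g M < g y :=
    hlt.filter_mono (nhdsWithin_mono _ fun y hy => ne_of_lt hy)
  obtain ⟨y, hy, hy1, hy2⟩ := (hlt'.and (Ioo_mem_nhdsLT hmM)).exists
  have : g y ≤ g M := hmax ⟨hy1.le, (hy2.le.trans hM.2)⟩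
  linarith

/-- The solutions of the same system do not vanish identically on `(0, 1)`. -/
lemma exists_ne_zero_of_bessel_system {B d : ℝ} (hB : 0 < B) {g p : ℝ → ℝ}
    (hg : ∀ r, 0 < r → HasDerivAt g (p r - g r / r) r)
    (hp : ∀ r, HasDerivAt p (B * (g r + r ^ 2 / 3 - d * r / 2)) r) :
    ∃ r ∈ Set.Ioo (0 : ℝ) 1, g r ≠ 0 := by
  by_contra! hcon
  have hp0 : ∀ r ∈ Set.Ioo (0 : ℝ) 1, p r = 0 := fun r hr => by
    have h : g =ᶠ[𝓝 r] fun _ => 0 := Filter.mem_of_superset (Ioo_mem_nhds hr.1 hr.2) hcon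
    have := (hg r hr.1).unique ((hasDerivAt_const r (0 : ℝ)).congr_of_eventuallyEq h)
    simpa [hcon r hr] using this
  have hs : ∀ r ∈ Set.Ioo (0 : ℝ) 1, r ^ 2 / 3 - d * r / 2 = 0 := fun r hr => by
    have h : p =ᶠ[𝓝 r] fun _ => 0 := Filter.mem_of_superset (Ioo_mem_nhds hr.1 hr.2) hp0
    have := (hp r).unique ((hasDerivAt_const r (0 : ℝ)).congr_of_eventuallyEq h)
    rw [hcon r hr, zero_add] at this
    exact (mul_eq_zero.1 this).resolve_left hB.ne'
  have h1 := hs (1 / 2) (by norm_num)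
  have h2 := hs (1 / 4) (by norm_num)
  linarith

end SingularODE

section Moments

lemma risingFactorial_mul_Gamma {a : ℝ} (ha : 0 < a) (k : ℕ) :
    risingFactorial a k * Real.Gamma a = Real.Gamma (k + a) := by
  induction k with
  | zero => simp [risingFactorial]
  | succ k ih =>
    rw [risingFactorial, Finset.prod_range_succ, ← risingFactorial, mul_right_comm, ih,
      show ((k + 1 : ℕ) : ℝ) + a = (k + a) + 1 by push_cast; ring,
      Real.Gamma_add_one (by positivity)]
    ring

lemma risingFactorial_natCast_succ (m k : ℕ) :
    risingFactorial (m + 1) k * (m.factorial : ℝ) = ((k + m).factorial : ℝ) := by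
  rw [← Real.Gamma_nat_eq_factorial, risingFactorial_mul_Gamma (by positivity),
    ← Real.Gamma_nat_eq_factorial]
  push_cast
  ring_nf

lemma hyp2F3_coeff (k : ℕ) :
    risingFactorial 1 k * risingFactorial 2 k /
      (risingFactorial (3 / 2) k * risingFactorial (5 / 2) k * risingFactorial 3 k) /
        (k.factorial : ℝ) =
    3 * Real.pi / 4 * ((Real.Gamma (k + 3 / 2) * Real.Gamma (k + (1 : ℕ) + 3 / 2))⁻¹ *
      (1 / ((k : ℝ) + 2))) := by
  have h1 := risingFactorial_natCast_succ 0 k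
  have h2 := risingFactorial_natCast_succ 1 k
  have h3 := risingFactorial_natCast_succ 2 k
  have h4 := risingFactorial_mul_Gamma (a := 3 / 2) (by norm_num) k
  have h5 := risingFactorial_mul_Gamma (a := 5 / 2) (by norm_num) k
  have h6 : Real.Gamma (5 / 2) = 3 / 4 * √Real.pi := by
    rw [show (5 / 2 : ℝ) = 3 / 2 + 1 by norm_num, Real.Gamma_add_one (by norm_num),
      Gamma_three_halves]
    ring
  rw [Gamma_three_halves] at h4
  rw [h6] at h5
  norm_num [Nat.factorial_succ, ← add_assoc, show k + 2 = k + 1 + 1 from rfl] at h1 h2 h3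
  have h7 := Gamma_add_three_halves_pos k
  have hpi : 0 < √Real.pi := Real.sqrt_pos.2 Real.pi_pos
  have e4 : risingFactorial (3 / 2) k = Real.Gamma (k + 3 / 2) * 2 / √Real.pi := by
    rw [← h4]; field_simp
  have e5 : risingFactorial (5 / 2) k = Real.Gamma (k + 5 / 2) * 4 / (3 * √Real.pi) := by
    rw [← h5]; field_simp
  have e3 : risingFactorial 3 k =
      ((k : ℝ) + 1 + 1) * (((k : ℝ) + 1) * (k.factorial : ℝ)) / 2 := by
    rw [← h3]; ring
  have h8 : 0 < Real.Gamma ((k : ℝ) + 5 / 2) := Real.Gamma_pos_of_pos (by positivity)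
  rw [h1, h2, e3, e4, e5, show (k : ℝ) + (1 : ℕ) + 3 / 2 = k + 5 / 2 by push_cast; ring]
  have hk : (0 : ℝ) < (k.factorial : ℝ) := by positivity
  field_simp
  rw [Real.sq_sqrt Real.pi_pos.le]
  ring

/-- The antiderivative of `x ↦ x * L₁ x`. -/
lemma hasDerivAt_hyp2F3_moment (x : ℝ) :
    HasDerivAt (fun y => y ^ 4 / (6 * Real.pi) * hyp2F3 (y ^ 2 / 4)) (x * struveL 1 x) x := by
  have hb : ∀ k : ℕ, |(Real.Gamma (k + 3 / 2) * Real.Gamma (k + (1 : ℕ) + 3 / 2))⁻¹ *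
      (1 / ((k : ℝ) + 2))| ≤ 4 / (k.factorial : ℝ) := fun k => by
    refine le_trans ?_ (abs_struveL_coeff_le 1 k)
    rw [abs_mul]
    refine mul_le_of_le_one_right (abs_nonneg _) ?_
    rw [abs_of_pos (by positivity), div_le_one (by positivity)]
    linarith [(Nat.cast_nonneg k : (0 : ℝ) ≤ k)]
  have h := (hasDerivAt_tsum_half_pow hb 3 x).const_mul 2
  refine (h.congr_deriv ?_).congr_of_eventuallyEq (.of_forall fun y => ?_)
  · symm
    rw [struveL_eq, ← tsum_mul_left, ← tsum_mul_left]
    refine tsum_congr fun k => ?_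
    have h1 : ((k : ℝ) + 2) ≠ 0 := by positivity
    push_cast
    field_simp
    ring
  · beta_reduce
    rw [hyp2F3, ← tsum_mul_left, ← tsum_mul_left]
    refine tsum_congr fun k => ?_
    rw [mul_div_right_comm, hyp2F3_coeff, show y ^ 2 / 4 = (y / 2) ^ 2 by ring, ← pow_mul]
    field_simp
    ring

lemma hasDerivAt_cross (x : ℝ) :
    HasDerivAt (fun y => y * besselI 1 y * struveL 0 y - besselI 0 y * (y * struveL 1 y))
      (2 / Real.pi * (x * besselI 1 x)) x := by
  refine (((hasDerivAt_mul_besselI_one x).mul (hasDerivAt_struveL_zero x)).sub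
    ((hasDerivAt_besselI_zero x).mul (hasDerivAt_mul_struveL_one x))).congr_deriv ?_
  ring

lemma besselI_one_zero : besselI 1 0 = 0 := by simp [besselI_eq]

lemma struveL_one_zero : struveL 1 0 = 0 := by simp [struveL_eq]

end Moments

section Profile

/-- The profile `d r / 2 - r ^ 2 / 3 + α I₁(κ r) + β L₁(κ r)`. -/
noncomputable def besselProfile (κ d α β r : ℝ) : ℝ :=
  d * r / 2 - r ^ 2 / 3 + α * besselI 1 (κ * r) + β * struveL 1 (κ * r)

/-- The slope `(r g)' / r` of `g = besselProfile κ d α β`. -/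
noncomputable def besselProfileSlope (κ d α β r : ℝ) : ℝ :=
  d - r + α * κ * besselI 0 (κ * r) + β * κ * struveL 0 (κ * r)

variable (κ d α β : ℝ)

lemma differentiable_besselProfile : Differentiable ℝ (besselProfile κ d α β) := by
  have hI : Differentiable ℝ (besselI 1) := differentiable_besselI_one
  have hL : Differentiable ℝ (struveL 1) := differentiable_struveL_one
  unfold besselProfile
  fun_prop

lemma hasDerivAt_comp_const_mul {f : ℝ → ℝ} {f' r : ℝ} (hf : HasDerivAt f f' (κ * r)) :
    HasDerivAt (fun y => f (κ * y)) (κ * f') r := by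
  have h := hf.comp r ((hasDerivAt_id' r).const_mul κ)
  rw [mul_one, mul_comm] at h
  exact h

lemma hasDerivAt_id_mul_besselProfile (hκ : κ ≠ 0) (r : ℝ) :
    HasDerivAt (fun y => y * besselProfile κ d α β y)
      (r * besselProfileSlope κ d α β r) r := by
  have hI := hasDerivAt_comp_const_mul κ (hasDerivAt_mul_besselI_one (κ * r))
  have hL := hasDerivAt_comp_const_mul κ (hasDerivAt_mul_struveL_one (κ * r))
  have h := (((((hasDerivAt_pow 2 r).const_mul (d / 2)).sub
    ((hasDerivAt_pow 3 r).const_mul (1 / 3))).add (hI.const_mul (α / κ))).add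
    (hL.const_mul (β / κ)))
  refine (h.congr_deriv ?_).congr_of_eventuallyEq (.of_forall fun y => ?_)
  · simp only [besselProfileSlope]
    push_cast
    field_simp
  · simp only [besselProfile, Pi.add_apply, Pi.sub_apply]
    field_simp

lemma hasDerivAt_besselProfile (hκ : κ ≠ 0) {r : ℝ} (hr : 0 < r) :
    HasDerivAt (besselProfile κ d α β)
      (besselProfileSlope κ d α β r - besselProfile κ d α β r / r) r := by
  have hd := (differentiable_besselProfile κ d α β r).hasDerivAt
  have h := ((hasDerivAt_id' r).mul hd).unique (hasDerivAt_id_mul_besselProfile κ d α β hκ r)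
  refine hd.congr_deriv ?_
  field_simp
  linarith

lemma hasDerivAt_besselProfileSlope (hβ : 2 * β * κ ^ 2 = Real.pi) (r : ℝ) :
    HasDerivAt (besselProfileSlope κ d α β)
      (κ ^ 2 * (besselProfile κ d α β r + r ^ 2 / 3 - d * r / 2)) r := by
  have hI := hasDerivAt_comp_const_mul κ (hasDerivAt_besselI_zero (κ * r))
  have hL := hasDerivAt_comp_const_mul κ (hasDerivAt_struveL_zero (κ * r))
  have h := ((((hasDerivAt_id' r).const_sub d).add (hI.const_mul (α * κ))).add
    (hL.const_mul (β * κ)))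
  refine h.congr_deriv ?_
  have hpi : β * κ * (κ * (2 / Real.pi)) = 1 := by
    field_simp
    linarith
  simp only [besselProfile]
  linear_combination hpi

lemma integral_besselProfile_mul (hκ : κ ≠ 0) :
    ∫ r in (0 : ℝ)..1, besselProfile κ d α β r * r =
      d / 6 - 1 / 12 + α * (Real.pi / (2 * κ)) *
        (besselI 1 κ * struveL 0 κ - besselI 0 κ * struveL 1 κ) +
      β * (κ ^ 2 / (6 * Real.pi)) * hyp2F3 (κ ^ 2 / 4) := by
  have hderiv : ∀ r : ℝ, HasDerivAt (fun y => d / 6 * y ^ 3 - 1 / 12 * y ^ 4 +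
      α * (Real.pi / (2 * κ ^ 2)) * (κ * y * besselI 1 (κ * y) * struveL 0 (κ * y) -
        besselI 0 (κ * y) * (κ * y * struveL 1 (κ * y))) +
      β / κ ^ 2 * ((κ * y) ^ 4 / (6 * Real.pi) * hyp2F3 ((κ * y) ^ 2 / 4)))
      (besselProfile κ d α β r * r) r := fun r => by
    have h1 := hasDerivAt_comp_const_mul κ (hasDerivAt_cross (κ * r))
    have h2 := hasDerivAt_comp_const_mul κ (hasDerivAt_hyp2F3_moment (κ * r))
    refine (((((hasDerivAt_pow 3 r).const_mul (d / 6)).sub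
      ((hasDerivAt_pow 4 r).const_mul (1 / 12))).add
      (h1.const_mul (α * (Real.pi / (2 * κ ^ 2))))).add
      (h2.const_mul (β / κ ^ 2))).congr_deriv ?_
    simp only [besselProfile]
    push_cast
    field_simp
    ring
  rw [intervalIntegral.integral_eq_sub_of_hasDerivAt (fun r _ => hderiv r)
    (((differentiable_besselProfile κ d α β).continuous.mul continuous_id).intervalIntegrable _ _)]
  simp only [mul_zero, mul_one, zero_mul, sub_zero, one_pow, zero_div, add_zero, ne_eq,
    OfNat.ofNat_ne_zero, not_false_eq_true, zero_pow]
  field_simp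

end Profile

theorem optimal_shape_radial_m_zero (V B : ℝ) (hV : 0 < V) (hB : 0 < B)
    (κ : ℝ) (hκ : κ = Real.sqrt B)
    (Υ : ℝ) (hΥ : Υ = besselI 1 κ * struveL 0 κ - besselI 0 κ * struveL 1 κ)
    (d₀ : ℝ) (hd : d₀ = (3 * Real.pi * Υ + 2 * B * besselI 0 κ -
      6 * Real.sqrt B * besselI 1 κ) / (3 * B * besselI 2 κ))
    (lam0 : ℝ)
    (hlam : lam0 = (18 * V / Real.pi) * (6 * d₀ - 3 +
      18 * (1 - d₀) * Real.pi * Υ / (B * besselI 0 κ) +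
      3 * hyp2F3 (B / 4) -
      9 * Real.pi ^ 2 * struveL 0 κ * Υ / (B ^ ((3 : ℝ) / 2) * besselI 0 κ))⁻¹)
    (h0 : ℝ → ℝ)
    (hh0 : ∀ r : ℝ, h0 r = lam0 / 3 * (3 * d₀ * r / 2 - r ^ 2) +
      lam0 * (1 - d₀) * besselI 1 (κ * r) / (κ * besselI 0 κ) +
      lam0 * Real.pi / (2 * B) *
        (struveL 1 (κ * r) - struveL 0 κ * besselI 1 (κ * r) / besselI 0 κ)) :
    h0 0 = 0 ∧ h0 1 = 0 ∧
    (∀ r ∈ Set.Icc (0 : ℝ) 1, 0 ≤ h0 r) ∧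
    (∫ r in (0 : ℝ)..1, h0 r * r) = V / (2 * Real.pi) ∧
    ¬ ConvexOn ℝ (Set.Icc (0 : ℝ) 1) (fun r => -h0 r) := by
  have hκ0 : 0 < κ := hκ ▸ Real.sqrt_pos.2 hB
  have hκB : κ ^ 2 = B := by rw [hκ, Real.sq_sqrt hB.le]
  rw [← hκ] at hd
  have hpow : B ^ ((3 : ℝ) / 2) = κ ^ 3 := by
    rw [← hκB, ← Real.rpow_natCast, ← Real.rpow_mul hκ0.le, ← Real.rpow_natCast]
    norm_num
  rw [hpow] at hlam
  clear hκ hpow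
  subst hκB
  have hI0 := besselI_pos 0 hκ0
  have hI2 := besselI_pos 2 hκ0
  have hrec := mul_besselI_two κ
  set β : ℝ := Real.pi / (2 * κ ^ 2) with hβ
  set α : ℝ := (1 - d₀) / (κ * besselI 0 κ) - β * struveL 0 κ / besselI 0 κ with hα
  set g : ℝ → ℝ := besselProfile κ d₀ α β with hgdef
  set p : ℝ → ℝ := besselProfileSlope κ d₀ α β with hpdef
  have hh : ∀ r, h0 r = lam0 * g r := fun r => by
    rw [hh0, hgdef, besselProfile, hα, hβ]
    field_simp
    ring
  have g0 : g 0 = 0 := by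
    simp [hgdef, besselProfile, besselI_one_zero, struveL_one_zero]
  have g1 : g 1 = 0 := by
    have hd' : d₀ * (3 * κ * (κ * besselI 0 κ - 2 * besselI 1 κ)) =
        3 * Real.pi * Υ + 2 * κ ^ 2 * besselI 0 κ - 6 * κ * besselI 1 κ := by
      rw [hd, ← hrec]
      field_simp
    simp only [hgdef, besselProfile, mul_one, hα, hβ]
    field_simp
    rw [hΥ] at hd'
    linear_combination hd'
  have p1 : p 1 = 0 := by
    simp only [hpdef, besselProfileSlope, mul_one, hα]
    field_simp
    ring
  have hgc : Continuous g := (differentiable_besselProfile κ d₀ α β).continuous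
  have hg : ∀ r, 0 < r → HasDerivAt g (p r - g r / r) r := fun r hr =>
    hasDerivAt_besselProfile κ d₀ α β hκ0.ne' hr
  have hp : ∀ r, HasDerivAt p (κ ^ 2 * (g r + r ^ 2 / 3 - d₀ * r / 2)) r :=
    hasDerivAt_besselProfileSlope κ d₀ α β (by rw [hβ]; field_simp)
  have hnonneg := nonneg_of_bessel_system hB hgc hg hp g0 g1 p1
  obtain ⟨r₀, hr₀, hne⟩ := exists_ne_zero_of_bessel_system hB hg hp
  have hpos : 0 < g r₀ := lt_of_le_of_ne (hnonneg r₀ (Set.Ioo_subset_Icc_self hr₀)) hne.symm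
  have hJ : 0 < ∫ r in (0 : ℝ)..1, g r * r :=
    intervalIntegral.integral_pos one_pos (hgc.mul continuous_id).continuousOn
      (fun r hr => mul_nonneg (hnonneg r (Set.Ioc_subset_Icc_self hr)) hr.1.le)
      ⟨r₀, Set.Ioo_subset_Icc_self hr₀, mul_pos hpos hr₀.1⟩
  have hlamJ : lam0 = 18 * V / Real.pi * (36 * ∫ r in (0 : ℝ)..1, g r * r)⁻¹ := by
    rw [hlam, hgdef, integral_besselProfile_mul κ d₀ α β hκ0.ne', ← hΥ, hα, hβ]
    congr 2
    field_simp
    ring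
  have hlam_pos : 0 < lam0 := by
    rw [hlamJ]
    positivity
  refine ⟨by rw [hh, g0, mul_zero], by rw [hh, g1, mul_zero],
    fun r hr => hh r ▸ mul_nonneg hlam_pos.le (hnonneg r hr), ?_, fun hconv => ?_⟩
  · simp only [hh, mul_assoc, intervalIntegral.integral_const_mul]
    rw [hlamJ]
    field_simp
    norm_num
  · have hd1 : HasDerivAt (fun r => -h0 r) 0 1 := by
      have h := ((hg 1 one_pos).const_mul lam0).neg
      simp only [p1, g1, zero_div, sub_zero, mul_zero, neg_zero] at h
      exact h.congr_of_eventuallyEq (.of_forall fun r => by simp [hh])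
    have hslope := hconv.slope_le_of_hasDerivAt (Set.Ioo_subset_Icc_self hr₀)
      (Set.right_mem_Icc.2 zero_le_one) hr₀.2 hd1
    rw [slope_def_field, hh, hh, g1] at hslope
    have : 0 < (-(lam0 * 0) - -(lam0 * g r₀)) / (1 - r₀) :=
      div_pos (by nlinarith [mul_pos hlam_pos hpos]) (by linarith [hr₀.2])
    linarith
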